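/- The 2-sphere S² is not an H-space; in particular, there is no continuous multiplication m : S² × S² → S² with a two-sided identity element. -/

import Mathlib

open MeasureTheory Set

namespace HS

/-- Partial derivative. -/
noncomputable def pd {n : ℕ} (i : Fin n) (f : (Fin n → ℝ) → ℝ) (x : Fin n → ℝ) : ℝ :=
  fderiv ℝ f x (Pi.single i 1)

lemma pd_add {n : ℕ} (i : Fin n) {f g : (Fin n → ℝ) → ℝ} (hf : Differentiable ℝ f)
    (hg : Differentiable ℝ g) (x : Fin n → ℝ) :
    pd i (fun x => f x + g x) x = pd i f x + pd i g x := by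
  unfold pd; rw [fderiv_fun_add (hf x) (hg x)]; rfl

lemma pd_sub {n : ℕ} (i : Fin n) {f g : (Fin n → ℝ) → ℝ} (hf : Differentiable ℝ f)
    (hg : Differentiable ℝ g) (x : Fin n → ℝ) :
    pd i (fun x => f x - g x) x = pd i f x - pd i g x := by
  unfold pd; rw [fderiv_fun_sub (hf x) (hg x)]; rfl

lemma pd_neg {n : ℕ} (i : Fin n) {f : (Fin n → ℝ) → ℝ} (x : Fin n → ℝ) :
    pd i (fun x => - f x) x = - pd i f x := by
  unfold pd; rw [fderiv_fun_neg]; rfl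

lemma pd_mul {n : ℕ} (i : Fin n) {f g : (Fin n → ℝ) → ℝ} (hf : Differentiable ℝ f)
    (hg : Differentiable ℝ g) (x : Fin n → ℝ) :
    pd i (fun x => f x * g x) x = pd i f x * g x + f x * pd i g x := by
  unfold pd; rw [fderiv_fun_mul (hf x) (hg x)]; simp; ring

lemma pd_const {n : ℕ} (i : Fin n) (c : ℝ) (x : Fin n → ℝ) :
    pd i (fun _ => c) x = 0 := by
  unfold pd; simp

lemma pd_contDiff {n : ℕ} (i : Fin n) {f : (Fin n → ℝ) → ℝ} (hf : ContDiff ℝ 2 f) :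
    ContDiff ℝ 1 (pd i f) := by
  unfold pd
  exact (hf.fderiv_right (m := 1) (by norm_num)).clm_apply contDiff_const

lemma pd_continuous {n : ℕ} (i : Fin n) {f : (Fin n → ℝ) → ℝ} (hf : ContDiff ℝ 1 f) :
    Continuous (pd i f) := by
  unfold pd
  exact (hf.continuous_fderiv (by norm_num)).clm_apply continuous_const

lemma pd_comm {n : ℕ} (i j : Fin n) {f : (Fin n → ℝ) → ℝ} (hf : ContDiff ℝ 2 f) (x) :
    pd i (pd j f) x = pd j (pd i f) x := by
  have hd : DifferentiableAt ℝ (fderiv ℝ f) x :=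
    ((hf.fderiv_right (m := 1) (by norm_num)).differentiable (by norm_num)) x
  have hs := (hf.contDiffAt (x := x)).isSymmSndFDerivAt (by simp)
  have key : ∀ i j : Fin n, pd i (pd j f) x
      = fderiv ℝ (fderiv ℝ f) x (Pi.single i 1) (Pi.single j 1) := by
    intro i j
    unfold pd
    rw [fderiv_clm_apply hd (by fun_prop)]
    simp
  rw [key, key]
  exact hs _ _

/-- Pulled-back area form `det (N, ∂ᵢ N, ∂ⱼ N)`. -/
noncomputable def al {n : ℕ} (N : Fin 3 → (Fin n → ℝ) → ℝ) (i j : Fin n) (x : Fin n → ℝ) : ℝ :=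
  N 0 x * (pd i (N 1) x * pd j (N 2) x - pd j (N 1) x * pd i (N 2) x)
  - N 1 x * (pd i (N 0) x * pd j (N 2) x - pd j (N 0) x * pd i (N 2) x)
  + N 2 x * (pd i (N 0) x * pd j (N 1) x - pd j (N 0) x * pd i (N 1) x)

lemma al_contDiff {n : ℕ} {N : Fin 3 → (Fin n → ℝ) → ℝ} (hN : ∀ k, ContDiff ℝ 2 (N k))
    (i j : Fin n) : ContDiff ℝ 1 (al N i j) := by
  have h1 : ∀ k, ContDiff ℝ 1 (N k) := fun k => (hN k).of_le (by norm_num)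
  have h2 : ∀ i k, ContDiff ℝ 1 (pd i (N k)) := fun i k => pd_contDiff i (hN k)
  unfold al
  have := h1 0; have := h1 1; have := h1 2
  have := h2 i 0; have := h2 i 1; have := h2 i 2
  have := h2 j 0; have := h2 j 1; have := h2 j 2
  fun_prop

lemma pd_al {n : ℕ} {N : Fin 3 → (Fin n → ℝ) → ℝ} (hN : ∀ k, ContDiff ℝ 2 (N k))
    (k i j : Fin n) (x) : pd k (al N i j) x =
    pd k (N 0) x * (pd i (N 1) x * pd j (N 2) x - pd j (N 1) x * pd i (N 2) x)
  - pd k (N 1) x * (pd i (N 0) x * pd j (N 2) x - pd j (N 0) x * pd i (N 2) x)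
  + pd k (N 2) x * (pd i (N 0) x * pd j (N 1) x - pd j (N 0) x * pd i (N 1) x)
  + N 0 x * (pd k (pd i (N 1)) x * pd j (N 2) x - pd j (N 1) x * pd k (pd i (N 2)) x)
  - N 1 x * (pd k (pd i (N 0)) x * pd j (N 2) x - pd j (N 0) x * pd k (pd i (N 2)) x)
  + N 2 x * (pd k (pd i (N 0)) x * pd j (N 1) x - pd j (N 0) x * pd k (pd i (N 1)) x)
  + N 0 x * (pd i (N 1) x * pd k (pd j (N 2)) x - pd k (pd j (N 1)) x * pd i (N 2) x)
  - N 1 x * (pd i (N 0) x * pd k (pd j (N 2)) x - pd k (pd j (N 0)) x * pd i (N 2) x)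
  + N 2 x * (pd i (N 0) x * pd k (pd j (N 1)) x - pd k (pd j (N 0)) x * pd i (N 1) x) := by
  have h1 : ∀ k, Differentiable ℝ (N k) := fun k => (hN k).differentiable (by norm_num)
  have h2 : ∀ i k, Differentiable ℝ (pd i (N k)) :=
    fun i k => (pd_contDiff i (hN k)).differentiable (by norm_num)
  have e : ∀ a b : Fin 3, ∀ x, pd k (fun x => pd i (N a) x * pd j (N b) x
      - pd j (N a) x * pd i (N b) x) x = _ := fun a b x => by
    rw [pd_sub k ((h2 i a).fun_mul (h2 j b)) ((h2 j a).fun_mul (h2 i b)),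
      pd_mul k (h2 i a) (h2 j b), pd_mul k (h2 j a) (h2 i b)]
  have d : ∀ a b : Fin 3, Differentiable ℝ (fun x => pd i (N a) x * pd j (N b) x
      - pd j (N a) x * pd i (N b) x) :=
    fun a b => ((h2 i a).fun_mul (h2 j b)).fun_sub ((h2 j a).fun_mul (h2 i b))
  unfold al
  rw [pd_add k (((h1 0).fun_mul (d 1 2)).fun_sub ((h1 1).fun_mul (d 0 2))) ((h1 2).fun_mul (d 0 1)),
    pd_sub k ((h1 0).fun_mul (d 1 2)) ((h1 1).fun_mul (d 0 2)),
    pd_mul k (h1 0) (d 1 2), pd_mul k (h1 1) (d 0 2), pd_mul k (h1 2) (d 0 1), e, e, e]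
  ring

lemma det_zero {N v w u : Fin 3 → ℝ} (hN : N 0 ^ 2 + N 1 ^ 2 + N 2 ^ 2 = 1)
    (hv : N 0 * v 0 + N 1 * v 1 + N 2 * v 2 = 0)
    (hw : N 0 * w 0 + N 1 * w 1 + N 2 * w 2 = 0)
    (hu : N 0 * u 0 + N 1 * u 1 + N 2 * u 2 = 0) :
    u 0 * (v 1 * w 2 - w 1 * v 2) - u 1 * (v 0 * w 2 - w 0 * v 2)
      + u 2 * (v 0 * w 1 - w 0 * v 1) = 0 := by
  set D := u 0 * (v 1 * w 2 - w 1 * v 2) - u 1 * (v 0 * w 2 - w 0 * v 2)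
      + u 2 * (v 0 * w 1 - w 0 * v 1) with hD
  have h0 : N 0 * D = 0 := by
    rw [hD]
    linear_combination (v 1 * w 2 - w 1 * v 2) * hu - (u 1 * w 2 - w 1 * u 2) * hv
      + (u 1 * v 2 - v 1 * u 2) * hw
  have h1 : N 1 * D = 0 := by
    rw [hD]
    linear_combination -(v 0 * w 2 - w 0 * v 2) * hu + (u 0 * w 2 - w 0 * u 2) * hv
      - (u 0 * v 2 - v 0 * u 2) * hw
  have h2 : N 2 * D = 0 := by
    rw [hD]
    linear_combination (v 0 * w 1 - w 0 * v 1) * hu - (u 0 * w 1 - w 0 * u 1) * hv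
      + (u 0 * v 1 - v 0 * u 1) * hw
  linear_combination (-D) * hN + N 0 * h0 + N 1 * h1 + N 2 * h2

lemma al_closed {n : ℕ} {N : Fin 3 → (Fin n → ℝ) → ℝ} (hN : ∀ k, ContDiff ℝ 2 (N k))
    (h1 : ∀ x, N 0 x ^ 2 + N 1 x ^ 2 + N 2 x ^ 2 = 1)
    (i j k : Fin n) (x) : pd k (al N i j) x + pd i (al N j k) x + pd j (al N k i) x = 0 := by
  have hd : ∀ k, Differentiable ℝ (N k) := fun k => (hN k).differentiable (by norm_num)
  have orth : ∀ l, N 0 x * pd l (N 0) x + N 1 x * pd l (N 1) x + N 2 x * pd l (N 2) x = 0 := by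
    intro l
    have e : (fun x => N 0 x * N 0 x + N 1 x * N 1 x + N 2 x * N 2 x) = fun _ => (1 : ℝ) := by
      funext y; linear_combination h1 y
    have := congrArg (fun f => pd l f x) e
    rw [pd_const, pd_add l (((hd 0).fun_mul (hd 0)).fun_add ((hd 1).fun_mul (hd 1))) ((hd 2).fun_mul (hd 2)),
      pd_add l ((hd 0).fun_mul (hd 0)) ((hd 1).fun_mul (hd 1)), pd_mul l (hd 0) (hd 0),
      pd_mul l (hd 1) (hd 1), pd_mul l (hd 2) (hd 2)] at this
    linarith
  have D := det_zero (N := fun a => N a x) (v := fun a => pd i (N a) x)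
    (w := fun a => pd j (N a) x) (u := fun a => pd k (N a) x) (h1 x) (orth i) (orth j) (orth k)
  rw [pd_al hN, pd_al hN, pd_al hN]
  rw [pd_comm k i (hN 0), pd_comm k i (hN 1), pd_comm k i (hN 2),
    pd_comm k j (hN 0), pd_comm k j (hN 1), pd_comm k j (hN 2),
    pd_comm j i (hN 0), pd_comm j i (hN 1), pd_comm j i (hN 2)]
  linear_combination 3 * D

lemma al_pluecker {N : Fin 3 → (Fin 4 → ℝ) → ℝ} (x) :
    al N 0 1 x * al N 2 3 x - al N 0 2 x * al N 1 3 x + al N 0 3 x * al N 1 2 x = 0 := by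
  unfold al; ring

lemma al_swap {n : ℕ} (N : Fin 3 → (Fin n → ℝ) → ℝ) (i j : Fin n) (x) :
    al N i j x = - al N j i x := by
  unfold al; ring

/-- Divergence theorem for fields periodic in all directions but the first. -/
lemma div_thm {n : ℕ} (G : Fin (n + 1) → (Fin (n + 1) → ℝ) → ℝ)
    (hG : ∀ i, ContDiff ℝ 1 (G i))
    (hper : ∀ (i : Fin n) (y : Fin (n + 1) → ℝ),
      G i.succ (y + Pi.single i.succ 1) = G i.succ y)
    (hdiv : ∀ x, ∑ i, pd i (G i) x = 0) :
    ∫ x in Icc (0 : Fin n → ℝ) 1, G 0 (Fin.cons 1 x)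
      = ∫ x in Icc (0 : Fin n → ℝ) 1, G 0 (Fin.cons 0 x) := by
  have h := integral_divergence_of_hasFDerivAt_off_countable' (0 : Fin (n + 1) → ℝ) 1
    (by intro i; simp) G (fun i x => fderiv ℝ (G i) x) ∅ countable_empty
    (fun i => (hG i).continuous.continuousOn)
    (fun x _ i => ((hG i).differentiable (by norm_num) x).hasFDerivAt)
    (by
      have : (fun x => ∑ i, fderiv ℝ (G i) x (Pi.single i 1)) = fun _ => (0 : ℝ) := by
        funext x; exact hdiv x
      rw [this]
      exact integrableOn_zero)
  have e0 : (fun x => ∑ i, fderiv ℝ (G i) x (Pi.single i 1)) = fun _ => (0 : ℝ) := by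
    funext x; exact hdiv x
  rw [e0, Fin.sum_univ_succ] at h
  have hz : ∀ i : Fin n, (∫ x in Icc ((0 : Fin (n + 1) → ℝ) ∘ i.succ.succAbove)
      ((1 : Fin (n + 1) → ℝ) ∘ i.succ.succAbove),
      G i.succ (i.succ.insertNth ((1 : Fin (n + 1) → ℝ) i.succ) x)) -
      ∫ x in Icc ((0 : Fin (n + 1) → ℝ) ∘ i.succ.succAbove)
      ((1 : Fin (n + 1) → ℝ) ∘ i.succ.succAbove),
      G i.succ (i.succ.insertNth ((0 : Fin (n + 1) → ℝ) i.succ) x) = 0 := by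
    intro i
    rw [sub_eq_zero]
    congr 1
    funext x
    refine Eq.trans ?_ (hper i _)
    congr 1
    funext k
    rcases Fin.eq_self_or_eq_succAbove i.succ k with rfl | ⟨l, rfl⟩
    · simp
    · simp [Fin.succAbove_ne]
  rw [Finset.sum_eq_zero (fun i _ => hz i)] at h
  simp only [integral_zero, add_zero] at h
  have h' := sub_eq_zero.1 h.symm
  simpa [Fin.insertNth_zero] using h'

lemma pd_comp_affine {n m : ℕ} (i : Fin n) {f : (Fin m → ℝ) → ℝ} {g : (Fin n → ℝ) → (Fin m → ℝ)}
    (hf : Differentiable ℝ f) (hg : Differentiable ℝ g) (x : Fin n → ℝ) (v : Fin m → ℝ)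
    (h : ∀ s : ℝ, g (x + s • Pi.single i 1) = g x + s • v) :
    pd i (fun x => f (g x)) x = fderiv ℝ f (g x) v := by
  unfold pd
  have h1 : DifferentiableAt ℝ (fun x => f (g x)) x := (hf.comp hg) x
  rw [← h1.lineDeriv_eq_fderiv, ← (hf (g x)).lineDeriv_eq_fderiv]
  unfold lineDeriv
  simp only [h]

lemma pd_slice {n : ℕ} (i : Fin n) {f : (Fin (n + 1) → ℝ) → ℝ} (hf : Differentiable ℝ f)
    (t : ℝ) (x : Fin n → ℝ) :
    pd i (fun x => f (Fin.cons t x)) x = pd i.succ f (Fin.cons t x) := by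
  have hg : Differentiable ℝ (fun x : Fin n → ℝ => (Fin.cons t x : Fin (n + 1) → ℝ)) := by
    rw [differentiable_pi]
    intro k
    refine Fin.cases ?_ (fun k => ?_) k
    · simp
    · simp only [Fin.cons_succ]; fun_prop
  refine pd_comp_affine i hf hg x (Pi.single i.succ 1) ?_
  intro s
  funext k
  refine Fin.cases ?_ (fun k => ?_) k
  · simp
  · simp [Pi.single_apply]

lemma pd_periodic {n : ℕ} (i : Fin n) {f : (Fin n → ℝ) → ℝ} {v : Fin n → ℝ}
    (h : ∀ y, f (y + v) = f y) (y) : pd i f (y + v) = pd i f y := by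
  unfold pd
  rw [← fderiv_comp_add_right]
  simp only [h]

lemma al_periodic {n : ℕ} {N : Fin 3 → (Fin n → ℝ) → ℝ} (i j : Fin n) {v : Fin n → ℝ}
    (h : ∀ k y, N k (y + v) = N k y) (y) : al N i j (y + v) = al N i j y := by
  unfold al
  simp only [h, fun i k => pd_periodic (f := N k) i (h k)]

lemma al_slice {n : ℕ} {H : Fin 3 → (Fin (n + 1) → ℝ) → ℝ} (hH : ∀ k, ContDiff ℝ 2 (H k))
    (i j : Fin n) (t : ℝ) (x) :
    al H i.succ j.succ (Fin.cons t x) = al (fun k x => H k (Fin.cons t x)) i j x := by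
  have hd : ∀ k, Differentiable ℝ (H k) := fun k => (hH k).differentiable (by norm_num)
  unfold al
  simp only [fun i k => pd_slice i (hd k)]

/-- Homotopy invariance of the mean of the `(i, j)` component. -/
lemma homotopy {n : ℕ} {H : Fin 3 → (Fin (n + 1) → ℝ) → ℝ} (hH : ∀ k, ContDiff ℝ 2 (H k))
    (h1 : ∀ x, H 0 x ^ 2 + H 1 x ^ 2 + H 2 x ^ 2 = 1) (i j : Fin n)
    (hi : ∀ k y, H k (y + Pi.single i.succ 1) = H k y)
    (hj : ∀ k y, H k (y + Pi.single j.succ 1) = H k y) :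
    ∫ x in Icc (0 : Fin n → ℝ) 1, al (fun k x => H k (Fin.cons 1 x)) i j x
      = ∫ x in Icc (0 : Fin n → ℝ) 1, al (fun k x => H k (Fin.cons 0 x)) i j x := by
  have hc := fun a b => al_contDiff hH a b
  have hdf := fun a b => (hc a b).differentiable (by norm_num)
  have hite : ∀ (p : Prop) [Decidable p] (a b : Fin (n + 1)),
      ContDiff ℝ 1 (fun x => if p then al H a b x else 0) := by
    intro p _ a b
    split_ifs
    · exact hc a b
    · exact contDiff_const
  let G : Fin (n + 1) → (Fin (n + 1) → ℝ) → ℝ := fun k x =>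
    ((if k = 0 then al H i.succ j.succ x else 0) + (if k = i.succ then al H j.succ 0 x else 0))
      + (if k = j.succ then al H 0 i.succ x else 0)
  have hpd : ∀ (p : Prop) [Decidable p] (a b k : Fin (n + 1)) (x),
      pd k (fun x => if p then al H a b x else 0) x = if p then pd k (al H a b) x else 0 := by
    intro p _ a b k x
    split_ifs
    · rfl
    · exact pd_const _ _ _
  have key := div_thm G
    (fun k => ((hite _ _ _).add (hite _ _ _)).add (hite _ _ _))
    (by
      intro l y
      simp only [G]
      have e0 : l.succ ≠ 0 := Fin.succ_ne_zero l
      simp only [e0, if_false]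
      congr 1
      · congr 1
        split_ifs with h
        · rw [h]; exact al_periodic _ _ hi y
        · rfl
      · split_ifs with h
        · rw [h]; exact al_periodic _ _ hj y
        · rfl)
    (by
      intro x
      have : ∀ k, pd k (G k) x = ((if k = 0 then pd k (al H i.succ j.succ) x else 0)
          + (if k = i.succ then pd k (al H j.succ 0) x else 0))
          + (if k = j.succ then pd k (al H 0 i.succ) x else 0) := by
        intro k
        simp only [G]
        rw [pd_add k (((hite _ _ _).add (hite _ _ _)).differentiable (by norm_num))
          ((hite _ _ _).differentiable (by norm_num)),
          pd_add k ((hite _ _ _).differentiable (by norm_num))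
          ((hite _ _ _).differentiable (by norm_num)), hpd, hpd, hpd]
      simp only [this, Finset.sum_add_distrib, Finset.sum_ite_eq', Finset.mem_univ, if_true]
      exact al_closed hH h1 i.succ j.succ 0 x)
  have e : ∀ t x, G 0 (Fin.cons t x) = al (fun k x => H k (Fin.cons t x)) i j x := by
    intro t x
    rw [← al_slice hH]
    simp [G, (Fin.succ_ne_zero _).symm]
  simpa only [e] using key

lemma clm_expand {n : ℕ} (L : (Fin n → ℝ) →L[ℝ] ℝ) (w : Fin n → ℝ) :
    L w = ∑ k, w k * L (Pi.single k 1) := by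
  have : w = ∑ k, w k • (Pi.single k 1 : Fin n → ℝ) := by
    funext l; simp [Finset.sum_apply, Pi.single_apply]
  conv_lhs => rw [this]
  simp only [map_sum, map_smul, smul_eq_mul]

/-- Translation invariance of the integral over a period cell. -/
lemma shift {n : ℕ} {f : (Fin n → ℝ) → ℝ} (hf : ContDiff ℝ 1 f)
    (hp : ∀ i y, f (y + Pi.single i 1) = f y) (w : Fin n → ℝ) :
    ∫ x in Icc (0 : Fin n → ℝ) 1, f (x + w) = ∫ x in Icc (0 : Fin n → ℝ) 1, f x := by
  let g : (Fin (n + 1) → ℝ) → (Fin n → ℝ) := fun y => Fin.tail y + y 0 • w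
  have hg : ContDiff ℝ 1 g := by
    rw [contDiff_pi]
    intro k
    simp only [g, Fin.tail, Pi.add_apply, Pi.smul_apply, smul_eq_mul]
    fun_prop
  have hfg : ContDiff ℝ 1 (fun y => f (g y)) := hf.comp hg
  have hfd := hf.differentiable (by norm_num)
  have hgd := hg.differentiable (by norm_num)
  let G : Fin (n + 1) → (Fin (n + 1) → ℝ) → ℝ :=
    Fin.cons (fun y => f (g y)) (fun k y => (- w k) * f (g y))
  have key := div_thm G
    (by
      intro k
      refine Fin.cases ?_ (fun k => ?_) k
      · simpa [G] using hfg
      · simp only [G, Fin.cons_succ]; exact contDiff_const.mul hfg)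
    (by
      intro l y
      simp only [G, Fin.cons_succ]
      congr 1
      rw [← hp l (g y)]
      congr 1
      funext k
      simp [g, Fin.tail, Pi.single_apply, (Fin.succ_ne_zero _).symm]
      ring)
    (by
      intro x
      rw [Fin.sum_univ_succ]
      simp only [G, Fin.cons_zero, Fin.cons_succ]
      have h0 : pd 0 (fun y => f (g y)) x = fderiv ℝ f (g x) w := by
        refine pd_comp_affine 0 hfd hgd x w ?_
        intro s; funext k; simp [g, Fin.tail]; ring
      have hk : ∀ k : Fin n, pd k.succ (fun y => - w k * f (g y)) x
          = - (w k * fderiv ℝ f (g x) (Pi.single k 1)) := by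
        intro k
        rw [pd_mul _ (by fun_prop) (hfg.differentiable (by norm_num)), pd_const,
          pd_comp_affine k.succ hfd hgd x (Pi.single k 1)]
        · ring
        · intro s; funext l
          simp [g, Fin.tail, Pi.single_apply, (Fin.succ_ne_zero _).symm]
          ring
      rw [h0, Finset.sum_congr rfl (fun k _ => hk k)]
      rw [clm_expand]
      simp)
  simpa [G, g] using key

lemma pd_tri {n : ℕ} (k : Fin n) {f₁ f₂ f₃ g₁ g₂ g₃ : (Fin n → ℝ) → ℝ}
    (hf₁ : Differentiable ℝ f₁) (hf₂ : Differentiable ℝ f₂) (hf₃ : Differentiable ℝ f₃)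
    (hg₁ : Differentiable ℝ g₁) (hg₂ : Differentiable ℝ g₂) (hg₃ : Differentiable ℝ g₃) (x) :
    pd k (fun x => f₁ x * g₁ x - f₂ x * g₂ x + f₃ x * g₃ x) x
      = pd k f₁ x * g₁ x + f₁ x * pd k g₁ x - (pd k f₂ x * g₂ x + f₂ x * pd k g₂ x)
        + (pd k f₃ x * g₃ x + f₃ x * pd k g₃ x) := by
  rw [pd_add k ((hf₁.fun_mul hg₁).fun_sub (hf₂.fun_mul hg₂)) (hf₃.fun_mul hg₃),
    pd_sub k (hf₁.fun_mul hg₁) (hf₂.fun_mul hg₂), pd_mul k hf₁ hg₁, pd_mul k hf₂ hg₂,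
    pd_mul k hf₃ hg₃]

lemma pd_lin {n : ℕ} (k : Fin n) {f₁ f₂ f₃ : (Fin n → ℝ) → ℝ} (a b c : ℝ)
    (hf₁ : Differentiable ℝ f₁) (hf₂ : Differentiable ℝ f₂) (hf₃ : Differentiable ℝ f₃) (x) :
    pd k (fun x => a * f₁ x + b * f₂ x + c * f₃ x) x
      = a * pd k f₁ x + b * pd k f₂ x + c * pd k f₃ x := by
  rw [pd_add k ((hf₁.const_mul a).fun_add (hf₂.const_mul b)) (hf₃.const_mul c),
    pd_add k (hf₁.const_mul a) (hf₂.const_mul b), pd_mul k (by fun_prop) hf₁,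
    pd_mul k (by fun_prop) hf₂, pd_mul k (by fun_prop) hf₃, pd_const, pd_const, pd_const]
  ring

/-- The polarised wedge square of a two-form with its translate. -/
noncomputable def W (A : Fin 4 → Fin 4 → (Fin 4 → ℝ) → ℝ) (x y : Fin 4 → ℝ) : ℝ :=
  (A 0 1 x * A 2 3 y - A 0 2 x * A 1 3 y + A 0 3 x * A 1 2 y)
    + (A 2 3 x * A 0 1 y - A 1 3 x * A 0 2 y + A 1 2 x * A 0 3 y)

lemma wedge_const {A : Fin 4 → Fin 4 → (Fin 4 → ℝ) → ℝ} (hA : ∀ i j, ContDiff ℝ 1 (A i j))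
    (hp : ∀ i j k y, A i j (y + Pi.single k 1) = A i j y)
    (hcl : ∀ i j k x, pd i (A j k) x - pd j (A i k) x + pd k (A i j) x = 0)
    (w : Fin 4 → ℝ) :
    ∫ x in Icc (0 : Fin 4 → ℝ) 1, W A x (x + w)
      = ∫ x in Icc (0 : Fin 4 → ℝ) 1, W A x x := by
  let T : (Fin 5 → ℝ) → (Fin 4 → ℝ) := fun y => Fin.tail y
  let g : (Fin 5 → ℝ) → (Fin 4 → ℝ) := fun y => Fin.tail y + y 0 • w
  have hT : ContDiff ℝ 1 T := by
    rw [contDiff_pi]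
    intro k
    simp only [T, Fin.tail]
    fun_prop
  have hg : ContDiff ℝ 1 g := by
    rw [contDiff_pi]
    intro k
    simp only [g, Fin.tail, Pi.add_apply, Pi.smul_apply, smul_eq_mul]
    fun_prop
  have hTd := hT.differentiable (by norm_num)
  have hgd := hg.differentiable (by norm_num)
  have hAd := fun i j => (hA i j).differentiable (by norm_num)
  let a : Fin 4 → Fin 4 → (Fin 5 → ℝ) → ℝ := fun i j y => A i j (T y)
  let a' : Fin 4 → Fin 4 → (Fin 5 → ℝ) → ℝ := fun i j y => A i j (g y)
  have ha : ∀ i j, ContDiff ℝ 1 (a i j) := fun i j => (hA i j).comp hT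
  have ha' : ∀ i j, ContDiff ℝ 1 (a' i j) := fun i j => (hA i j).comp hg
  have had := fun i j => (ha i j).differentiable (by norm_num)
  have had' := fun i j => (ha' i j).differentiable (by norm_num)
  have ap : ∀ i j (l : Fin 4) y, a i j (y + Pi.single l.succ 1) = a i j y := by
    intro i j l y
    simp only [a]
    rw [← hp i j l (T y)]
    congr 1
    funext k
    simp [T, Fin.tail, Pi.single_apply]
  have ap' : ∀ i j (l : Fin 4) y, a' i j (y + Pi.single l.succ 1) = a' i j y := by
    intro i j l y
    simp only [a']
    rw [← hp i j l (g y)]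
    congr 1
    funext k
    simp [g, Fin.tail, Pi.single_apply, (Fin.succ_ne_zero _).symm]
    ring
  have d0 : ∀ i j x, pd 0 (a i j) x = 0 := by
    intro i j x
    have := pd_comp_affine 0 (hAd i j) hTd x 0 (by intro s; funext k; simp [T, Fin.tail])
    simpa using this
  have ds : ∀ i j (l : Fin 4) x, pd l.succ (a i j) x = pd l (A i j) (T x) := by
    intro i j l x
    refine pd_comp_affine l.succ (hAd i j) hTd x (Pi.single l 1) ?_
    intro s; funext k; simp [T, Fin.tail, Pi.single_apply]
  have d0' : ∀ i j x, pd 0 (a' i j) x = w 0 * pd 0 (A i j) (g x) + w 1 * pd 1 (A i j) (g x)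
      + w 2 * pd 2 (A i j) (g x) + w 3 * pd 3 (A i j) (g x) := by
    intro i j x
    have := pd_comp_affine 0 (hAd i j) hgd x w
      (by intro s; funext k; simp [g, Fin.tail]; ring)
    rw [clm_expand, Fin.sum_univ_four] at this
    exact this
  have ds' : ∀ i j (l : Fin 4) x, pd l.succ (a' i j) x = pd l (A i j) (g x) := by
    intro i j l x
    refine pd_comp_affine l.succ (hAd i j) hgd x (Pi.single l 1) ?_
    intro s; funext k
    simp [g, Fin.tail, Pi.single_apply, (Fin.succ_ne_zero _).symm]
    ring
  let b0 : (Fin 5 → ℝ) → ℝ := fun y => (-w 1) * a' 0 1 y + (-w 2) * a' 0 2 y + (-w 3) * a' 0 3 y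
  let b1 : (Fin 5 → ℝ) → ℝ := fun y => w 0 * a' 0 1 y + (-w 2) * a' 1 2 y + (-w 3) * a' 1 3 y
  let b2 : (Fin 5 → ℝ) → ℝ := fun y => w 0 * a' 0 2 y + w 1 * a' 1 2 y + (-w 3) * a' 2 3 y
  let b3 : (Fin 5 → ℝ) → ℝ := fun y => w 0 * a' 0 3 y + w 1 * a' 1 3 y + w 2 * a' 2 3 y
  have hb : ∀ (c d e : ℝ) (i j k l m n : Fin 4),
      ContDiff ℝ 1 (fun y => c * a' i j y + d * a' k l y + e * a' m n y) :=
    fun c d e i j k l m n => ((contDiff_const.mul (ha' i j)).add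
      (contDiff_const.mul (ha' k l))).add (contDiff_const.mul (ha' m n))
  have hb0 : ContDiff ℝ 1 b0 := hb _ _ _ _ _ _ _ _ _
  have hb1 : ContDiff ℝ 1 b1 := hb _ _ _ _ _ _ _ _ _
  have hb2 : ContDiff ℝ 1 b2 := hb _ _ _ _ _ _ _ _ _
  have hb3 : ContDiff ℝ 1 b3 := hb _ _ _ _ _ _ _ _ _
  have ht : ∀ {f₁ f₂ f₃ g₁ g₂ g₃ : (Fin 5 → ℝ) → ℝ}, ContDiff ℝ 1 f₁ → ContDiff ℝ 1 f₂ →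
      ContDiff ℝ 1 f₃ → ContDiff ℝ 1 g₁ → ContDiff ℝ 1 g₂ → ContDiff ℝ 1 g₃ →
      ContDiff ℝ 1 (fun x => f₁ x * g₁ x - f₂ x * g₂ x + f₃ x * g₃ x) :=
    fun h₁ h₂ h₃ k₁ k₂ k₃ => ((h₁.mul k₁).sub (h₂.mul k₂)).add (h₃.mul k₃)
  let P : (Fin 5 → ℝ) → ℝ := fun y => a 0 1 y * a' 2 3 y - a 0 2 y * a' 1 3 y + a 0 3 y * a' 1 2 y
  let Q : (Fin 5 → ℝ) → ℝ := fun y => a 2 3 y * a' 0 1 y - a 1 3 y * a' 0 2 y + a 1 2 y * a' 0 3 y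
  let X0 : (Fin 5 → ℝ) → ℝ := fun y => a 1 2 y * b3 y - a 1 3 y * b2 y + a 2 3 y * b1 y
  let X1 : (Fin 5 → ℝ) → ℝ := fun y => a 0 2 y * b3 y - a 0 3 y * b2 y + a 2 3 y * b0 y
  let X2 : (Fin 5 → ℝ) → ℝ := fun y => a 0 1 y * b3 y - a 0 3 y * b1 y + a 1 3 y * b0 y
  let X3 : (Fin 5 → ℝ) → ℝ := fun y => a 0 1 y * b2 y - a 0 2 y * b1 y + a 1 2 y * b0 y
  have hP : ContDiff ℝ 1 P := ht (ha _ _) (ha _ _) (ha _ _) (ha' _ _) (ha' _ _) (ha' _ _)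
  have hQ : ContDiff ℝ 1 Q := ht (ha _ _) (ha _ _) (ha _ _) (ha' _ _) (ha' _ _) (ha' _ _)
  have hX0 : ContDiff ℝ 1 X0 := ht (ha _ _) (ha _ _) (ha _ _) hb3 hb2 hb1
  have hX1 : ContDiff ℝ 1 X1 := ht (ha _ _) (ha _ _) (ha _ _) hb3 hb2 hb0
  have hX2 : ContDiff ℝ 1 X2 := ht (ha _ _) (ha _ _) (ha _ _) hb3 hb1 hb0
  have hX3 : ContDiff ℝ 1 X3 := ht (ha _ _) (ha _ _) (ha _ _) hb2 hb1 hb0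
  have hb0d := hb0.differentiable (by norm_num)
  have hb1d := hb1.differentiable (by norm_num)
  have hb2d := hb2.differentiable (by norm_num)
  have hb3d := hb3.differentiable (by norm_num)
  let G : Fin 5 → (Fin 5 → ℝ) → ℝ :=
    ![fun y => P y + Q y, fun y => - X0 y, X1, fun y => - X2 y, X3]
  have key := div_thm G
    (by
      intro k
      fin_cases k
      · exact hP.add hQ
      · exact hX0.neg
      · exact hX1
      · exact hX2.neg
      · exact hX3)
    (by
      intro l y
      have B0 : ∀ l : Fin 4, b0 (y + Pi.single l.succ 1) = b0 y := by
        intro l; simp only [b0, ap']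
      have B1 : ∀ l : Fin 4, b1 (y + Pi.single l.succ 1) = b1 y := by
        intro l; simp only [b1, ap']
      have B2 : ∀ l : Fin 4, b2 (y + Pi.single l.succ 1) = b2 y := by
        intro l; simp only [b2, ap']
      have B3 : ∀ l : Fin 4, b3 (y + Pi.single l.succ 1) = b3 y := by
        intro l; simp only [b3, ap']
      fin_cases l
      · change - X0 (y + Pi.single (Fin.succ 0) 1) = - X0 y
        simp only [X0, ap, B1, B2, B3]
      · change X1 (y + Pi.single (Fin.succ 1) 1) = X1 y
        simp only [X1, ap, B0, B2, B3]
      · change - X2 (y + Pi.single (Fin.succ 2) 1) = - X2 y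
        simp only [X2, ap, B0, B1, B3]
      · change X3 (y + Pi.single (Fin.succ 3) 1) = X3 y
        simp only [X3, ap, B0, B1, B2])
    (by
      intro x
      rw [Fin.sum_univ_five]
      change pd 0 (fun y => P y + Q y) x + pd (Fin.succ 0) (fun y => - X0 y) x
        + pd (Fin.succ 1) X1 x + pd (Fin.succ 2) (fun y => - X2 y) x + pd (Fin.succ 3) X3 x = 0
      rw [pd_add 0 (hP.differentiable (by norm_num)) (hQ.differentiable (by norm_num)),
        pd_neg, pd_neg]
      simp only [P, Q, X0, X1, X2, X3]
      rw [pd_tri 0 (had _ _) (had _ _) (had _ _) (had' _ _) (had' _ _) (had' _ _),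
        pd_tri 0 (had _ _) (had _ _) (had _ _) (had' _ _) (had' _ _) (had' _ _),
        pd_tri _ (had _ _) (had _ _) (had _ _) hb3d hb2d hb1d,
        pd_tri _ (had _ _) (had _ _) (had _ _) hb3d hb2d hb0d,
        pd_tri _ (had _ _) (had _ _) (had _ _) hb3d hb1d hb0d,
        pd_tri _ (had _ _) (had _ _) (had _ _) hb2d hb1d hb0d]
      simp only [b0, b1, b2, b3]
      simp only [fun k a b c i j l m n o => pd_lin k a b c (had' i j) (had' l m) (had' n o),
        d0, ds, d0', ds']
      simp only [a, a']
      have c012 := hcl 0 1 2 (T x)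
      have c013 := hcl 0 1 3 (T x)
      have c023 := hcl 0 2 3 (T x)
      have c123 := hcl 1 2 3 (T x)
      have e012 := hcl 0 1 2 (g x)
      have e013 := hcl 0 1 3 (g x)
      have e023 := hcl 0 2 3 (g x)
      have e123 := hcl 1 2 3 (g x)
      linear_combination A 0 1 (T x) * (w 0 * e023 + w 1 * e123)
        - A 0 2 (T x) * (w 0 * e013 - w 2 * e123)
        + A 0 3 (T x) * (w 0 * e012 + w 3 * e123)
        + A 2 3 (T x) * (w 2 * e012 + w 3 * e013)
        - A 1 3 (T x) * (- w 1 * e012 + w 3 * e023)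
        + A 1 2 (T x) * (- w 1 * e013 - w 2 * e023)
        - c012 * (w 0 * A 0 3 (g x) + w 1 * A 1 3 (g x) + w 2 * A 2 3 (g x))
        + c013 * (w 0 * A 0 2 (g x) + w 1 * A 1 2 (g x) - w 3 * A 2 3 (g x))
        - c023 * (w 0 * A 0 1 (g x) - w 2 * A 1 2 (g x) - w 3 * A 1 3 (g x))
        + c123 * (-w 1 * A 0 1 (g x) - w 2 * A 0 2 (g x) - w 3 * A 0 3 (g x)))
  simpa [G, P, Q, a, a', T, g, W] using key

lemma wedge_avg {A : Fin 4 → Fin 4 → (Fin 4 → ℝ) → ℝ} (hA : ∀ i j, ContDiff ℝ 1 (A i j))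
    (hp : ∀ i j k y, A i j (y + Pi.single k 1) = A i j y) (i j k l : Fin 4) :
    ∫ w in Icc (0 : Fin 4 → ℝ) 1, ∫ x in Icc (0 : Fin 4 → ℝ) 1, A i j x * A k l (x + w)
      = (∫ x in Icc (0 : Fin 4 → ℝ) 1, A i j x) * ∫ x in Icc (0 : Fin 4 → ℝ) 1, A k l x := by
  rw [integral_integral_swap]
  · simp only [integral_const_mul]
    have : ∀ x : Fin 4 → ℝ, ∫ w in Icc (0 : Fin 4 → ℝ) 1, A k l (x + w)
        = ∫ w in Icc (0 : Fin 4 → ℝ) 1, A k l w := by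
      intro x
      rw [← shift (hA k l) (hp k l) x]
      simp only [add_comm]
    simp only [this, integral_mul_const]
  · rw [Measure.prod_restrict]
    have hc : Continuous (fun p : (Fin 4 → ℝ) × (Fin 4 → ℝ) => A i j p.2 * A k l (p.2 + p.1)) :=
      ((hA i j).continuous.comp continuous_snd).mul
        ((hA k l).continuous.comp (continuous_snd.add continuous_fst))
    exact hc.continuousOn.integrableOn_compact (isCompact_Icc.prod isCompact_Icc)

lemma integral_six {f₁ f₂ f₃ f₄ f₅ f₆ : (Fin 4 → ℝ) → ℝ} {s : Set (Fin 4 → ℝ)}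
    (h₁ : IntegrableOn f₁ s) (h₂ : IntegrableOn f₂ s) (h₃ : IntegrableOn f₃ s)
    (h₄ : IntegrableOn f₄ s) (h₅ : IntegrableOn f₅ s) (h₆ : IntegrableOn f₆ s) :
    ∫ x in s, ((f₁ x - f₂ x + f₃ x) + (f₄ x - f₅ x + f₆ x))
      = ((∫ x in s, f₁ x) - (∫ x in s, f₂ x) + ∫ x in s, f₃ x)
        + ((∫ x in s, f₄ x) - (∫ x in s, f₅ x) + ∫ x in s, f₆ x) := by
  have a₁ : ∫ x in s, ((f₁ x - f₂ x + f₃ x) + (f₄ x - f₅ x + f₆ x))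
      = (∫ x in s, (f₁ x - f₂ x + f₃ x)) + ∫ x in s, (f₄ x - f₅ x + f₆ x) :=
    integral_add ((h₁.sub h₂).add h₃) ((h₄.sub h₅).add h₆)
  have a₂ : ∫ x in s, (f₁ x - f₂ x + f₃ x) = (∫ x in s, (f₁ x - f₂ x)) + ∫ x in s, f₃ x :=
    integral_add (h₁.sub h₂) h₃
  have a₃ : ∫ x in s, (f₄ x - f₅ x + f₆ x) = (∫ x in s, (f₄ x - f₅ x)) + ∫ x in s, f₆ x :=
    integral_add (h₄.sub h₅) h₆
  rw [a₁, a₂, a₃, integral_sub h₁ h₂, integral_sub h₄ h₅]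

/-- A pointwise decomposable closed periodic two-form has decomposable mean. -/
lemma mean_pluecker {A : Fin 4 → Fin 4 → (Fin 4 → ℝ) → ℝ} (hA : ∀ i j, ContDiff ℝ 1 (A i j))
    (hp : ∀ i j k y, A i j (y + Pi.single k 1) = A i j y)
    (hcl : ∀ i j k x, pd i (A j k) x - pd j (A i k) x + pd k (A i j) x = 0)
    (hpl : ∀ x, A 0 1 x * A 2 3 x - A 0 2 x * A 1 3 x + A 0 3 x * A 1 2 x = 0) :
    (∫ x in Icc (0 : Fin 4 → ℝ) 1, A 0 1 x) * (∫ x in Icc (0 : Fin 4 → ℝ) 1, A 2 3 x)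
    - (∫ x in Icc (0 : Fin 4 → ℝ) 1, A 0 2 x) * (∫ x in Icc (0 : Fin 4 → ℝ) 1, A 1 3 x)
    + (∫ x in Icc (0 : Fin 4 → ℝ) 1, A 0 3 x) * (∫ x in Icc (0 : Fin 4 → ℝ) 1, A 1 2 x) = 0 := by
  have hW : ∀ w, ∫ x in Icc (0 : Fin 4 → ℝ) 1, W A x (x + w) = 0 := by
    intro w
    rw [wedge_const hA hp hcl w]
    have : ∀ x, W A x x = 0 := by
      intro x; unfold W; linear_combination 2 * hpl x
    simp [this]
  have hcc : ∀ i j k l (w : Fin 4 → ℝ), Continuous (fun x => A i j x * A k l (x + w)) := by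
    intro i j k l w
    exact (hA i j).continuous.mul ((hA k l).continuous.comp (continuous_id.add continuous_const))
  have hInt : ∀ i j k l (w : Fin 4 → ℝ),
      IntegrableOn (fun x => A i j x * A k l (x + w)) (Icc 0 1) :=
    fun i j k l w => (hcc i j k l w).continuousOn.integrableOn_compact isCompact_Icc
  have hInt2 : ∀ i j k l, IntegrableOn
      (fun w : Fin 4 → ℝ => ∫ x in Icc (0 : Fin 4 → ℝ) 1, A i j x * A k l (x + w)) (Icc 0 1) := by
    intro i j k l
    refine Continuous.integrableOn_Icc ?_
    refine continuous_parametric_integral_of_continuous ?_ isCompact_Icc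
    exact ((hA i j).continuous.comp continuous_snd).mul
        ((hA k l).continuous.comp (continuous_snd.add continuous_fst))
  have e : ∀ w, ∫ x in Icc (0 : Fin 4 → ℝ) 1, W A x (x + w) =
      ((∫ x in Icc (0 : Fin 4 → ℝ) 1, A 0 1 x * A 2 3 (x + w))
      - (∫ x in Icc (0 : Fin 4 → ℝ) 1, A 0 2 x * A 1 3 (x + w))
      + (∫ x in Icc (0 : Fin 4 → ℝ) 1, A 0 3 x * A 1 2 (x + w)))
      + ((∫ x in Icc (0 : Fin 4 → ℝ) 1, A 2 3 x * A 0 1 (x + w))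
      - (∫ x in Icc (0 : Fin 4 → ℝ) 1, A 1 3 x * A 0 2 (x + w))
      + (∫ x in Icc (0 : Fin 4 → ℝ) 1, A 1 2 x * A 0 3 (x + w))) := by
    intro w
    unfold W
    exact integral_six (hInt _ _ _ _ w) (hInt _ _ _ _ w) (hInt _ _ _ _ w) (hInt _ _ _ _ w)
      (hInt _ _ _ _ w) (hInt _ _ _ _ w)
  have tot : ∫ w in Icc (0 : Fin 4 → ℝ) 1, ∫ x in Icc (0 : Fin 4 → ℝ) 1, W A x (x + w) = 0 := by
    simp [hW]
  simp only [e] at tot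
  rw [integral_six (hInt2 _ _ _ _) (hInt2 _ _ _ _) (hInt2 _ _ _ _) (hInt2 _ _ _ _)
    (hInt2 _ _ _ _) (hInt2 _ _ _ _)] at tot
  simp only [wedge_avg hA hp] at tot
  linear_combination (1 / 2) * tot

/-- Components of the normalisation of a vector-valued map. -/
noncomputable def nz {n : ℕ} (G : (Fin n → ℝ) → EuclideanSpace ℝ (Fin 3)) (k : Fin 3)
    (x : Fin n → ℝ) : ℝ := ‖G x‖⁻¹ * G x k

lemma nz_contDiff {n : ℕ} {G : (Fin n → ℝ) → EuclideanSpace ℝ (Fin 3)} (hG : ContDiff ℝ 2 G)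
    (h0 : ∀ x, G x ≠ 0) (k : Fin 3) : ContDiff ℝ 2 (nz G k) := by
  have h1 : ContDiff ℝ 2 (fun x => ‖G x‖⁻¹) := (hG.norm ℝ h0).inv (fun x => norm_ne_zero_iff.2 (h0 x))
  have h2 : ContDiff ℝ 2 (fun x => G x k) := (contDiff_euclidean.1 hG) k
  exact h1.mul h2

lemma nz_unit {n : ℕ} {G : (Fin n → ℝ) → EuclideanSpace ℝ (Fin 3)}
    (h0 : ∀ x, G x ≠ 0) (x) : nz G 0 x ^ 2 + nz G 1 x ^ 2 + nz G 2 x ^ 2 = 1 := by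
  have h := EuclideanSpace.norm_sq_eq (G x)
  rw [Fin.sum_univ_three] at h
  simp only [Real.norm_eq_abs, sq_abs] at h
  have hn : ‖G x‖ ≠ 0 := norm_ne_zero_iff.2 (h0 x)
  unfold nz
  have : (‖G x‖⁻¹ * G x 0) ^ 2 + (‖G x‖⁻¹ * G x 1) ^ 2 + (‖G x‖⁻¹ * G x 2) ^ 2
      = ‖G x‖⁻¹ ^ 2 * (G x 0 ^ 2 + G x 1 ^ 2 + G x 2 ^ 2) := by ring
  rw [this, ← h]
  field_simp

lemma lin_homotopy {G C : (Fin 4 → ℝ) → EuclideanSpace ℝ (Fin 3)} (hG : ContDiff ℝ 2 G)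
    (hC : ContDiff ℝ 2 C) (hC1 : ∀ x, ‖C x‖ = 1) (hGC : ∀ x, ‖G x - C x‖ ≤ 1 / 2) (i j : Fin 4)
    (hGi : ∀ x, G (x + Pi.single i 1) = G x) (hGj : ∀ x, G (x + Pi.single j 1) = G x)
    (hCi : ∀ x, C (x + Pi.single i 1) = C x) (hCj : ∀ x, C (x + Pi.single j 1) = C x) :
    ∫ x in Icc (0 : Fin 4 → ℝ) 1, al (nz G) i j x = ∫ x in Icc (0 : Fin 4 → ℝ) 1, al (nz C) i j x := by
  let T : (Fin 5 → ℝ) → (Fin 4 → ℝ) := fun y => Fin.tail y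
  have hT : ContDiff ℝ 2 T := by
    rw [contDiff_pi]
    intro k
    simp only [T, Fin.tail]
    fun_prop
  let H : (Fin 5 → ℝ) → EuclideanSpace ℝ (Fin 3) :=
    fun y => C (T y) + Real.sin (Real.pi / 2 * y 0) • (G (T y) - C (T y))
  have hH : ContDiff ℝ 2 H := by
    have h1 : ContDiff ℝ 2 (fun y => C (T y)) := hC.comp hT
    have h2 : ContDiff ℝ 2 (fun y => G (T y)) := hG.comp hT
    have h3 : ContDiff ℝ 2 (fun y : Fin 5 → ℝ => Real.sin (Real.pi / 2 * y 0)) := by fun_prop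
    exact h1.add (h3.smul (h2.sub h1))
  have hH0 : ∀ y, H y ≠ 0 := by
    intro y hy
    have e : C (T y) = - (Real.sin (Real.pi / 2 * y 0) • (G (T y) - C (T y))) :=
      eq_neg_of_add_eq_zero_left hy
    have := congrArg norm e
    rw [hC1, norm_neg, norm_smul, Real.norm_eq_abs] at this
    have h1 := Real.abs_sin_le_one (Real.pi / 2 * y 0)
    have h2 := hGC (T y)
    have h3 := norm_nonneg (G (T y) - C (T y))
    nlinarith [abs_nonneg (Real.sin (Real.pi / 2 * y 0))]
  have hper : ∀ l : Fin 4, (∀ x, G (x + Pi.single l 1) = G x) → (∀ x, C (x + Pi.single l 1) = C x) →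
      ∀ k y, nz H k (y + Pi.single l.succ 1) = nz H k y := by
    intro l h1 h2 k y
    have e : T (y + Pi.single l.succ 1) = T y + Pi.single l 1 := by
      funext m; simp [T, Fin.tail, Pi.single_apply]
    have : H (y + Pi.single l.succ 1) = H y := by
      simp only [H, e, h1, h2]
      simp [(Fin.succ_ne_zero _).symm]
    simp only [nz, this]
  have key := homotopy (H := nz H) (nz_contDiff hH hH0) (nz_unit hH0) i j
    (hper i hGi hCi) (hper j hGj hCj)
  have e1 : (fun (k : Fin 3) (x : Fin 4 → ℝ) => nz H k (Fin.cons 1 x)) = nz G := by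
    funext k x
    simp [nz, H, T]
  have e0 : (fun (k : Fin 3) (x : Fin 4 → ℝ) => nz H k (Fin.cons 0 x)) = nz C := by
    funext k x
    simp [nz, H, T]
  rw [e1, e0] at key
  exact key

/-- Scale all coordinates except `i`, `j` by `t`. -/
def rho (i j : Fin 4) (t : ℝ) (x : Fin 4 → ℝ) : Fin 4 → ℝ :=
  fun k => if k = i ∨ k = j then x k else t * x k

lemma rest_homotopy {N : Fin 3 → (Fin 4 → ℝ) → ℝ} (hN : ∀ k, ContDiff ℝ 2 (N k))
    (h1 : ∀ x, N 0 x ^ 2 + N 1 x ^ 2 + N 2 x ^ 2 = 1) (i j : Fin 4)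
    (hi : ∀ k x, N k (x + Pi.single i 1) = N k x) (hj : ∀ k x, N k (x + Pi.single j 1) = N k x) :
    ∫ x in Icc (0 : Fin 4 → ℝ) 1, al N i j x
      = ∫ x in Icc (0 : Fin 4 → ℝ) 1, al (fun k x => N k (rho i j 0 x)) i j x := by
  let g : (Fin 5 → ℝ) → (Fin 4 → ℝ) := fun y => rho i j (y 0) (Fin.tail y)
  have hg : ContDiff ℝ 2 g := by
    rw [contDiff_pi]
    intro k
    simp only [g, rho, Fin.tail]
    split_ifs <;> fun_prop
  have hgp : ∀ l, l = i ∨ l = j → ∀ y, g (y + Pi.single l.succ 1) = g y + Pi.single l 1 := by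
    intro l hl y
    funext k
    by_cases hk : k = l
    · subst hk; simp [g, rho, Fin.tail, hl]
    · simp [g, rho, Fin.tail, hk, (Fin.succ_ne_zero _).symm]
  have key := homotopy (H := fun k y => N k (g y)) (fun k => (hN k).comp hg)
    (fun x => h1 _) i j
    (by intro k y; simp only [hgp i (Or.inl rfl), hi])
    (by intro k y; simp only [hgp j (Or.inr rfl), hj])
  have e1 : (fun (k : Fin 3) (x : Fin 4 → ℝ) => N k (g (Fin.cons 1 x))) = N := by
    funext k x
    congr 1
    funext l
    simp [g, rho]
  have e0 : (fun (k : Fin 3) (x : Fin 4 → ℝ) => N k (g (Fin.cons 0 x)))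
      = fun k x => N k (rho i j 0 x) := by
    funext k x
    simp [g]
  rw [e1, e0] at key
  exact key

lemma rho_add (i j : Fin 4) (t : ℝ) (l : Fin 4) (hl : l = i ∨ l = j) (x) :
    rho i j t (x + Pi.single l 1) = rho i j t x + Pi.single l 1 := by
  funext k
  by_cases hk : k = l
  · subst hk; simp [rho, hl]
  · simp [rho, hk]

lemma mean_eq {G C : (Fin 4 → ℝ) → EuclideanSpace ℝ (Fin 3)} (hG : ContDiff ℝ 2 G)
    (hG0 : ∀ x, G x ≠ 0)
    (hC : ContDiff ℝ 2 C) (hC1 : ∀ x, ‖C x‖ = 1) (i j : Fin 4)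
    (hGC : ∀ x, ‖G (rho i j 0 x) - C x‖ ≤ 1 / 2)
    (hGp : ∀ l x, G (x + Pi.single l 1) = G x)
    (hCp : ∀ l x, C (x + Pi.single l 1) = C x) :
    ∫ x in Icc (0 : Fin 4 → ℝ) 1, al (nz G) i j x = ∫ x in Icc (0 : Fin 4 → ℝ) 1, al (nz C) i j x := by
  rw [rest_homotopy (nz_contDiff hG hG0) (nz_unit hG0) i j
    (by intro k x; simp only [nz, hGp]) (by intro k x; simp only [nz, hGp])]
  have hr : ContDiff ℝ 2 (rho i j 0) := by
    rw [contDiff_pi]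
    intro k
    simp only [rho]
    split_ifs <;> fun_prop
  exact lin_homotopy (G := fun x => G (rho i j 0 x)) (hG.comp hr) hC hC1 hGC i j
    (by intro x; simp only [rho_add i j 0 i (Or.inl rfl), hGp])
    (by intro x; simp only [rho_add i j 0 j (Or.inr rfl), hGp]) (hCp i) (hCp j)

lemma approx {F : (Fin 4 → ℝ) → EuclideanSpace ℝ (Fin 3)} (hc : Continuous F)
    (hp : ∀ x (z : Fin 4 → ℤ), F (fun i => x i + z i) = F x) :
    ∃ G : (Fin 4 → ℝ) → EuclideanSpace ℝ (Fin 3), ContDiff ℝ 2 G ∧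
      (∀ l x, G (x + Pi.single l 1) = G x) ∧ ∀ x, ‖G x - F x‖ ≤ 1 / 2 := by
  have hu := (isCompact_Icc (a := (-1 : Fin 4 → ℝ)) (b := 2)).uniformContinuousOn_of_continuous
    hc.continuousOn
  rw [Metric.uniformContinuousOn_iff] at hu
  obtain ⟨δ, hδ, hu⟩ := hu (1 / 2) (by norm_num)
  set r := min δ 1 with hr
  have hr0 : 0 < r := lt_min hδ one_pos
  have hu' : ∀ x y, dist y x < r → dist (F y) (F x) ≤ 1 / 2 := by
    intro x y hxy
    have ex := hp x (fun i => - ⌊x i⌋)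
    have ey := hp y (fun i => - ⌊x i⌋)
    rw [← ex, ← ey]
    have hk : ∀ k, |y k - x k| < 1 := by
      intro k
      have := (dist_pi_lt_iff hr0).1 hxy k
      rw [Real.dist_eq] at this
      exact this.trans_le (min_le_right _ _)
    apply le_of_lt
    apply hu
    · constructor <;> intro k <;> have := abs_lt.1 (hk k) <;> have := Int.floor_le (x k) <;>
        have := Int.lt_floor_add_one (x k) <;> simp <;> linarith
    · constructor <;> intro k <;> have := Int.floor_le (x k) <;>
        have := Int.lt_floor_add_one (x k) <;> simp <;> linarith
    · rw [dist_pi_lt_iff hδ]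
      intro k
      have := (dist_pi_lt_iff hr0).1 hxy k
      simp only [dist_add_right]
      exact this.trans_le (min_le_left _ _)
  let φ : ContDiffBump (0 : Fin 4 → ℝ) := ⟨r / 2, r, by positivity, by linarith⟩
  refine ⟨convolution (φ.normed volume) F (ContinuousLinearMap.lsmul ℝ ℝ) volume, ?_, ?_, ?_⟩
  · exact φ.hasCompactSupport_normed.contDiff_convolution_left (n := 2) _ φ.contDiff_normed
      hc.locallyIntegrable
  · intro l x
    rw [convolution_def, convolution_def]
    congr 1
    funext t
    congr 1
    rw [← hp (x - t) (Pi.single l 1)]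
    congr 1
    funext k
    by_cases hk : k = l
    · subst hk; simp; ring
    · simp [hk]
  · intro x
    rw [← dist_eq_norm]
    refine φ.dist_normed_convolution_le hc.aestronglyMeasurable ?_
    intro y hy
    exact hu' x y hy

/-- Unnormalised parametrisation of the sphere by the torus, collapsing `t = 0`. -/
noncomputable def VV (s t : ℝ) : EuclideanSpace ℝ (Fin 3) :=
  !₂[expNegInvGlue (Real.sin (2 * Real.pi * t)) * Real.cos (2 * Real.pi * s)
      + expNegInvGlue (- Real.sin (2 * Real.pi * t)),
    expNegInvGlue (Real.sin (2 * Real.pi * t)) * Real.sin (2 * Real.pi * s),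
    Real.cos (2 * Real.pi * t)]

noncomputable def cc (s t : ℝ) : EuclideanSpace ℝ (Fin 3) := ‖VV s t‖⁻¹ • VV s t

lemma VV_ne (s t : ℝ) : VV s t ≠ 0 := by
  intro h
  have h0 : expNegInvGlue (Real.sin (2 * Real.pi * t)) * Real.cos (2 * Real.pi * s)
      + expNegInvGlue (- Real.sin (2 * Real.pi * t)) = 0 := congrArg (fun v => v 0) h
  have h1 : expNegInvGlue (Real.sin (2 * Real.pi * t)) * Real.sin (2 * Real.pi * s) = 0 :=
    congrArg (fun v => v 1) h
  have h2 : Real.cos (2 * Real.pi * t) = 0 := congrArg (fun v => v 2) h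
  have h3 := Real.sin_sq_add_cos_sq (2 * Real.pi * t)
  have h4 := Real.sin_sq_add_cos_sq (2 * Real.pi * s)
  rcases lt_trichotomy (Real.sin (2 * Real.pi * t)) 0 with h | h | h
  · rw [expNegInvGlue.zero_of_nonpos h.le] at h0
    have := expNegInvGlue.pos_of_pos (neg_pos.2 h)
    linarith
  · rw [h2, h] at h3; norm_num at h3
  · have hp := expNegInvGlue.pos_of_pos h
    rw [expNegInvGlue.zero_of_nonpos (x := - _) (by linarith)] at h0
    have e0 : Real.cos (2 * Real.pi * s) = 0 := by
      rw [add_zero] at h0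
      rcases mul_eq_zero.1 h0 with h | h
      · linarith
      · exact h
    have e1 : Real.sin (2 * Real.pi * s) = 0 := by
      rcases mul_eq_zero.1 h1 with h | h
      · linarith
      · exact h
    rw [e0, e1] at h4; norm_num at h4

lemma cc_norm (s t : ℝ) : ‖cc s t‖ = 1 := by
  unfold cc
  rw [norm_smul, norm_inv, norm_norm, inv_mul_cancel₀ (norm_ne_zero_iff.2 (VV_ne s t))]

lemma VV_contDiff : ContDiff ℝ 2 (fun p : ℝ × ℝ => VV p.1 p.2) := by
  have hg : ContDiff ℝ 2 expNegInvGlue := expNegInvGlue.contDiff (n := 2)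
  have h1 : ContDiff ℝ 2 (fun p : ℝ × ℝ => expNegInvGlue (Real.sin (2 * Real.pi * p.2))) :=
    hg.comp (by fun_prop)
  have h2 : ContDiff ℝ 2 (fun p : ℝ × ℝ => expNegInvGlue (-Real.sin (2 * Real.pi * p.2))) :=
    hg.comp (by fun_prop)
  rw [contDiff_euclidean]
  intro k
  fin_cases k
  · simp only [VV]
    exact (h1.mul (by fun_prop)).add h2
  · simp only [VV]
    exact (h1.mul (by fun_prop))
  · simp only [VV]
    exact (by fun_prop : ContDiff ℝ 2 (fun p : ℝ × ℝ => Real.cos (2 * Real.pi * p.2)))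

lemma VVinv_contDiff : ContDiff ℝ 2 (fun p : ℝ × ℝ => ‖VV p.1 p.2‖⁻¹) :=
  (VV_contDiff.norm ℝ (fun p => VV_ne p.1 p.2)).inv (fun p => norm_ne_zero_iff.2 (VV_ne p.1 p.2))

lemma cc_contDiff : ContDiff ℝ 2 (fun p : ℝ × ℝ => cc p.1 p.2) :=
  VVinv_contDiff.smul VV_contDiff

lemma VV_per (s t : ℝ) (m n : ℤ) : VV (s + m) (t + n) = VV s t := by
  have e : ∀ (a : ℝ) (k : ℤ), 2 * Real.pi * (a + k) = 2 * Real.pi * a + k * (2 * Real.pi) := by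
    intro a k; ring
  unfold VV
  rw [e, e]
  simp only [Real.sin_add_int_mul_two_pi, Real.cos_add_int_mul_two_pi]

lemma cc_per (s t : ℝ) (m n : ℤ) : cc (s + m) (t + n) = cc s t := by
  unfold cc; rw [VV_per]

lemma cc_zero (s : ℝ) : cc s 0 = cc 0 0 := by
  unfold cc VV; simp

lemma pd_coord {n : ℕ} (i j : Fin n) {f : ℝ → ℝ} {f' : ℝ} (x : Fin n → ℝ)
    (hf : HasDerivAt f f' (x j)) :
    pd i (fun x => f (x j)) x = if j = i then f' else 0 := by
  unfold pd
  have h := hf.comp_hasFDerivAt x (hasFDerivAt_apply (𝕜 := ℝ) j x)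
  have e : fderiv ℝ (fun x : Fin n → ℝ => f (x j)) x = f' • ContinuousLinearMap.proj j := h.fderiv
  rw [e]
  simp [Pi.single_apply]

lemma al_scale {n : ℕ} {r : (Fin n → ℝ) → ℝ} {M : Fin 3 → (Fin n → ℝ) → ℝ}
    (hr : Differentiable ℝ r) (hM : ∀ k, Differentiable ℝ (M k)) (i j : Fin n) (x) :
    al (fun k x => r x * M k x) i j x = r x ^ 3 * al M i j x := by
  unfold al
  simp only [fun i k => pd_mul i hr (hM k)]
  ring

lemma al_zero {n : ℕ} {N : Fin 3 → (Fin n → ℝ) → ℝ} (i j : Fin n) (x)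
    (h : ∀ k, pd i (N k) x = 0) : al N i j x = 0 := by
  unfold al; simp [h]

lemma expderiv_nonneg (u : ℝ) : 0 ≤ deriv expNegInvGlue u :=
  expNegInvGlue.monotone.deriv_nonneg

lemma expderiv_zero {u : ℝ} (hu : u < 0) : deriv expNegInvGlue u = 0 := by
  have : expNegInvGlue =ᶠ[nhds u] fun _ => 0 := by
    filter_upwards [Iio_mem_nhds hu] with v hv
    exact expNegInvGlue.zero_of_nonpos (le_of_lt hv)
  rw [this.deriv_eq]; simp

lemma al_VV (i j : Fin 4) (hij : i ≠ j) (x : Fin 4 → ℝ) :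
    al (fun k x => VV (x i) (x j) k) i j x =
      - ((2 * Real.pi) ^ 2 * expNegInvGlue (Real.sin (2 * Real.pi * x j)) *
        (Real.sin (2 * Real.pi * x j) * expNegInvGlue (Real.sin (2 * Real.pi * x j))
        + Real.cos (2 * Real.pi * x j) ^ 2 *
          deriv expNegInvGlue (Real.sin (2 * Real.pi * x j)))) := by
  have hgd : Differentiable ℝ expNegInvGlue :=
    (expNegInvGlue.contDiff (n := 1)).differentiable (by norm_num)
  have lin : ∀ t : ℝ, HasDerivAt (fun t => 2 * Real.pi * t) (2 * Real.pi) t := by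
    intro t; simpa using (hasDerivAt_id t).const_mul (2 * Real.pi)
  have hsin : ∀ t, HasDerivAt (fun t => Real.sin (2 * Real.pi * t))
    (Real.cos (2 * Real.pi * t) * (2 * Real.pi)) t := fun t => (lin t).sin
  have hcos : ∀ t, HasDerivAt (fun t => Real.cos (2 * Real.pi * t))
    (- Real.sin (2 * Real.pi * t) * (2 * Real.pi)) t := fun t => (lin t).cos
  let P : ℝ → ℝ := fun t => expNegInvGlue (Real.sin (2 * Real.pi * t))
  let Q : ℝ → ℝ := fun t => expNegInvGlue (- Real.sin (2 * Real.pi * t))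
  have hP : ∀ t, HasDerivAt P (deriv expNegInvGlue (Real.sin (2 * Real.pi * t)) *
      (Real.cos (2 * Real.pi * t) * (2 * Real.pi))) t :=
    fun t => (hgd _).hasDerivAt.comp t (hsin t)
  have hQ : ∀ t, HasDerivAt Q (deriv expNegInvGlue (- Real.sin (2 * Real.pi * t)) *
      (- (Real.cos (2 * Real.pi * t) * (2 * Real.pi)))) t :=
    fun t => (hgd _).hasDerivAt.comp t (hsin t).neg
  have dco : ∀ (f : ℝ → ℝ) (l : Fin 4), Differentiable ℝ f →
      Differentiable ℝ (fun x : Fin 4 → ℝ => f (x l)) := by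
    intro f l hf
    exact hf.comp (by fun_prop)
  have DP : Differentiable ℝ (fun x : Fin 4 → ℝ => P (x j)) :=
    dco P j fun t => (hP t).differentiableAt
  have DQ : Differentiable ℝ (fun x : Fin 4 → ℝ => Q (x j)) :=
    dco Q j fun t => (hQ t).differentiableAt
  have DC : Differentiable ℝ (fun x : Fin 4 → ℝ => Real.cos (2 * Real.pi * x i)) :=
    dco (fun t => Real.cos (2 * Real.pi * t)) i fun t => (hcos t).differentiableAt
  have DS : Differentiable ℝ (fun x : Fin 4 → ℝ => Real.sin (2 * Real.pi * x i)) :=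
    dco (fun t => Real.sin (2 * Real.pi * t)) i fun t => (hsin t).differentiableAt
  have p0 : ∀ l, pd l (fun x : Fin 4 → ℝ => VV (x i) (x j) 0) x = _ := fun l => by
    change pd l (fun x : Fin 4 → ℝ => P (x j) * Real.cos (2 * Real.pi * x i) + Q (x j)) x = _
    rw [pd_add l (DP.fun_mul DC) DQ, pd_mul l DP DC, pd_coord l j x (hP (x j)),
      pd_coord l j x (hQ (x j)), pd_coord l i x (hcos (x i))]
  have p1 : ∀ l, pd l (fun x : Fin 4 → ℝ => VV (x i) (x j) 1) x = _ := fun l => by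
    change pd l (fun x : Fin 4 → ℝ => P (x j) * Real.sin (2 * Real.pi * x i)) x = _
    rw [pd_mul l DP DS, pd_coord l j x (hP (x j)), pd_coord l i x (hsin (x i))]
  have p2 : ∀ l, pd l (fun x : Fin 4 → ℝ => VV (x i) (x j) 2) x = _ := fun l => by
    change pd l (fun x : Fin 4 → ℝ => Real.cos (2 * Real.pi * x j)) x = _
    rw [pd_coord l j x (hcos (x j))]
  have v0 : VV (x i) (x j) 0 = P (x j) * Real.cos (2 * Real.pi * x i) + Q (x j) := rfl
  have v1 : VV (x i) (x j) 1 = P (x j) * Real.sin (2 * Real.pi * x i) := rfl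
  have v2 : VV (x i) (x j) 2 = Real.cos (2 * Real.pi * x j) := rfl
  unfold al
  simp only [p0, p1, p2, v0, v1, v2, if_true, if_neg hij, if_neg hij.symm]
  have hPQ : P (x j) * Q (x j) = 0 := by
    rcases le_total (Real.sin (2 * Real.pi * x j)) 0 with h | h
    · simp [P, expNegInvGlue.zero_of_nonpos h]
    · have : - Real.sin (2 * Real.pi * x j) ≤ 0 := by linarith
      simp [Q, expNegInvGlue.zero_of_nonpos this]
  have hPQ' : P (x j) * deriv expNegInvGlue (- Real.sin (2 * Real.pi * x j)) = 0 := by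
    rcases le_or_gt (Real.sin (2 * Real.pi * x j)) 0 with h | h
    · simp [P, expNegInvGlue.zero_of_nonpos h]
    · rw [expderiv_zero (by linarith)]; simp
  have hs := Real.sin_sq_add_cos_sq (2 * Real.pi * x i)
  change _ = - ((2 * Real.pi) ^ 2 * P (x j) * (Real.sin (2 * Real.pi * x j) * P (x j)
    + Real.cos (2 * Real.pi * x j) ^ 2 * deriv expNegInvGlue (Real.sin (2 * Real.pi * x j))))
  generalize P (x j) = p at *
  generalize Q (x j) = q at *
  generalize deriv expNegInvGlue (- Real.sin (2 * Real.pi * x j)) = q' at *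
  generalize deriv expNegInvGlue (Real.sin (2 * Real.pi * x j)) = p' at *
  generalize Real.sin (2 * Real.pi * x j) = u at *
  generalize Real.cos (2 * Real.pi * x j) = v at *
  generalize Real.sin (2 * Real.pi * x i) = sa at *
  generalize Real.cos (2 * Real.pi * x i) = ca at *
  generalize Real.pi = π at *
  linear_combination (- (4 * π ^ 2 * p * (u * p + v ^ 2 * p'))) * hs
    + (-4 * π ^ 2 * u * ca) * hPQ + (4 * π ^ 2 * v ^ 2 * ca) * hPQ'

lemma pair_contDiff (i j : Fin 4) : ContDiff ℝ 2 (fun x : Fin 4 → ℝ => (x i, x j)) :=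
  (contDiff_apply ℝ ℝ i).prodMk (contDiff_apply ℝ ℝ j)

attribute [irreducible] VV cc

lemma mean_neg (i j : Fin 4) (hij : i ≠ j) :
    ∫ x in Icc (0 : Fin 4 → ℝ) 1, al (nz (fun x => cc (x i) (x j))) i j x < 0 := by
  have hC : ContDiff ℝ 2 (fun x : Fin 4 → ℝ => cc (x i) (x j)) :=
    ContDiff.comp (g := fun p : ℝ × ℝ => cc p.1 p.2) (f := fun x : Fin 4 → ℝ => (x i, x j))
      cc_contDiff (pair_contDiff i j)
  have hV : ContDiff ℝ 2 (fun x : Fin 4 → ℝ => VV (x i) (x j)) :=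
    ContDiff.comp (g := fun p : ℝ × ℝ => VV p.1 p.2) (f := fun x : Fin 4 → ℝ => (x i, x j))
      VV_contDiff (pair_contDiff i j)
  have hr : ContDiff ℝ 2 (fun x : Fin 4 → ℝ => ‖VV (x i) (x j)‖⁻¹) :=
    ContDiff.comp (g := fun p : ℝ × ℝ => ‖VV p.1 p.2‖⁻¹) (f := fun x : Fin 4 → ℝ => (x i, x j))
      VVinv_contDiff (pair_contDiff i j)
  have hC0 : ∀ x : Fin 4 → ℝ, cc (x i) (x j) ≠ 0 := by
    intro x h
    have := cc_norm (x i) (x j)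
    rw [h] at this; simp at this
  have hcont := (al_contDiff (nz_contDiff hC hC0) i j).continuous
  have e : nz (fun x : Fin 4 → ℝ => cc (x i) (x j))
      = fun k x => ‖VV (x i) (x j)‖⁻¹ * VV (x i) (x j) k := by
    funext k x
    simp only [nz, cc_norm]
    simp [cc]
  have hval : ∀ x, al (nz (fun x => cc (x i) (x j))) i j x = ‖VV (x i) (x j)‖⁻¹ ^ 3 *
      - ((2 * Real.pi) ^ 2 * expNegInvGlue (Real.sin (2 * Real.pi * x j)) *
        (Real.sin (2 * Real.pi * x j) * expNegInvGlue (Real.sin (2 * Real.pi * x j))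
        + Real.cos (2 * Real.pi * x j) ^ 2 *
          deriv expNegInvGlue (Real.sin (2 * Real.pi * x j)))) := by
    intro x
    rw [e, al_scale (hr.differentiable (by norm_num))
      (fun k => ((contDiff_euclidean.1 hV) k).differentiable (by norm_num)), al_VV i j hij]
  set f := fun x => - al (nz (fun x => cc (x i) (x j))) i j x with hf
  have hrp : ∀ x : Fin 4 → ℝ, 0 < ‖VV (x i) (x j)‖⁻¹ ^ 3 := fun x =>
    pow_pos (inv_pos.2 (norm_pos_iff.2 (VV_ne _ _))) 3
  have fnn : ∀ x, 0 ≤ f x := by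
    intro x
    simp only [hf, hval]
    rw [mul_neg, neg_neg]
    refine mul_nonneg (hrp x).le (mul_nonneg (mul_nonneg (by positivity) (expNegInvGlue.nonneg _))
      (add_nonneg ?_ (mul_nonneg (sq_nonneg _) (expderiv_nonneg _))))
    rcases le_total (Real.sin (2 * Real.pi * x j)) 0 with h | h
    · simp [expNegInvGlue.zero_of_nonpos h]
    · exact mul_nonneg h (expNegInvGlue.nonneg _)
  have fpos : ∀ x : Fin 4 → ℝ, (∀ k, x k ∈ Ioo (0 : ℝ) (1 / 2)) → 0 < f x := by
    intro x hx
    have hs : 0 < Real.sin (2 * Real.pi * x j) := by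
      apply Real.sin_pos_of_pos_of_lt_pi
      · exact mul_pos (by positivity) (hx j).1
      · nlinarith [(hx j).2, Real.pi_pos]
    have hp := expNegInvGlue.pos_of_pos hs
    simp only [hf, hval]
    rw [mul_neg, neg_neg]
    refine mul_pos (hrp x) (mul_pos (mul_pos (by positivity) hp)
      (add_pos_of_pos_of_nonneg (mul_pos hs hp) (mul_nonneg (sq_nonneg _) (expderiv_nonneg _))))
  have hInt : IntegrableOn f (Icc 0 1) := hcont.neg.continuousOn.integrableOn_compact isCompact_Icc
  have hpos : 0 < ∫ x in Icc (0 : Fin 4 → ℝ) 1, f x := by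
    rw [setIntegral_pos_iff_support_of_nonneg_ae (Filter.Eventually.of_forall fnn) hInt]
    have hopen : IsOpen (Set.pi univ fun _ : Fin 4 => Ioo (0 : ℝ) (1 / 2)) :=
      isOpen_set_pi finite_univ (fun _ _ => isOpen_Ioo)
    refine lt_of_lt_of_le (hopen.measure_pos volume ⟨fun _ => 1 / 4, ?_⟩) (measure_mono ?_)
    · intro k _; constructor <;> norm_num
    · intro x hx
      refine ⟨(fpos x fun k => hx k trivial).ne', fun k => (hx k trivial).1.le, fun k => ?_⟩
      have := (hx k trivial).2
      simp; linarith
  rw [hf, integral_neg] at hpos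
  linarith

lemma pd_indep {n : ℕ} (i : Fin n) {f : (Fin n → ℝ) → ℝ} (hf : Differentiable ℝ f) (x)
    (h : ∀ s : ℝ, f (x + s • Pi.single i 1) = f x) : pd i f x = 0 := by
  unfold pd
  rw [← (hf x).lineDeriv_eq_fderiv]
  unfold lineDeriv
  simp [h]

theorem core {F : (Fin 4 → ℝ) → EuclideanSpace ℝ (Fin 3)} (hc : Continuous F)
    (h1 : ∀ x, ‖F x‖ = 1)
    (hp : ∀ x (z : Fin 4 → ℤ), F (fun i => x i + z i) = F x)
    (hl : ∀ x, x 3 = 0 → F x = cc (x 0) (x 1))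
    (hr : ∀ x, x 1 = 0 → F x = cc (x 2) (x 3)) : False := by
  obtain ⟨G, hG, hGp, hGF⟩ := approx hc hp
  have hG0 : ∀ x, G x ≠ 0 := by
    intro x h
    have := hGF x
    rw [h, zero_sub, norm_neg, h1] at this
    norm_num at this
  have hN := nz_contDiff hG hG0
  have hU := nz_unit hG0
  have hcd : ∀ u v : (Fin 4 → ℝ) → ℝ, ContDiff ℝ 2 u → ContDiff ℝ 2 v →
      ContDiff ℝ 2 (fun x => cc (u x) (v x)) := fun u v hu hv =>
    ContDiff.comp (g := fun p : ℝ × ℝ => cc p.1 p.2) (f := fun x : Fin 4 → ℝ => (u x, v x))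
      cc_contDiff (hu.prodMk hv)
  have hnp : ∀ k l x, nz G k (x + Pi.single l 1) = nz G k x := by
    intro k l x; simp only [nz, hGp]
  have pl := mean_pluecker (A := al (nz G)) (al_contDiff hN)
    (fun i j l y => al_periodic i j (fun k y => hnp k l y) y)
    (by
      intro i j k x
      have := al_closed hN hU i j k x
      have e : al (nz G) i k = fun x => - al (nz G) k i x := by
        funext x; exact al_swap _ _ _ _
      rw [e, pd_neg]
      linarith)
    al_pluecker
  have cper : ∀ (i j l : Fin 4) (x : Fin 4 → ℝ),
      cc ((x + Pi.single l 1 : Fin 4 → ℝ) i) ((x + Pi.single l 1 : Fin 4 → ℝ) j) = cc (x i) (x j) := by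
    intro i j l x
    have := cc_per (x i) (x j) ((Pi.single l 1 : Fin 4 → ℤ) i) ((Pi.single l 1 : Fin 4 → ℤ) j)
    rw [← this]
    congr 1 <;> simp [Pi.single_apply]
  have a01 := mean_eq hG hG0 (C := fun x => cc (x 0) (x 1))
    (hcd (fun x => x 0) (fun x => x 1) (by fun_prop) (by fun_prop)) (fun x => cc_norm _ _) 0 1
    (by
      intro x
      have := hGF (rho 0 1 0 x)
      rwa [hl _ (by simp [rho])] at this) hGp (cper 0 1)
  have a23 := mean_eq hG hG0 (C := fun x => cc (x 2) (x 3))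
    (hcd (fun x => x 2) (fun x => x 3) (by fun_prop) (by fun_prop)) (fun x => cc_norm _ _) 2 3
    (by
      intro x
      have := hGF (rho 2 3 0 x)
      rwa [hr _ (by simp [rho])] at this) hGp (cper 2 3)
  have hz : ∀ (u v : (Fin 4 → ℝ) → ℝ) (hu : ContDiff ℝ 2 u) (hv : ContDiff ℝ 2 v)
      (_ : ∀ x (s : ℝ), u (x + s • Pi.single 0 1) = u x)
      (_ : ∀ x (s : ℝ), v (x + s • Pi.single 0 1) = v x) (j : Fin 4),
      ∫ x in Icc (0 : Fin 4 → ℝ) 1, al (nz (fun x => cc (u x) (v x))) 0 j x = 0 := by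
    intro u v hu hv hu' hv' j
    have h0 : ∀ x : Fin 4 → ℝ, cc (u x) (v x) ≠ 0 := by
      intro x h
      have := cc_norm (u x) (v x)
      rw [h] at this; simp at this
    have : ∀ x, al (nz (fun x => cc (u x) (v x))) 0 j x = 0 := by
      intro x
      apply al_zero
      intro k
      apply pd_indep 0 ((nz_contDiff (hcd u v hu hv) h0 k).differentiable (by norm_num))
      intro s
      simp only [nz, hu', hv']
    simp [this]
  have a02 := mean_eq hG hG0 (C := fun _ => cc 0 0)
    (hcd (fun _ => 0) (fun _ => 0) (by fun_prop) (by fun_prop)) (fun x => cc_norm _ _) 0 2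
    (by
      intro x
      have := hGF (rho 0 2 0 x)
      rw [hr _ (by simp [rho])] at this
      have e : rho 0 2 0 x 3 = 0 := by simp [rho]
      rwa [e, cc_zero] at this) hGp (fun _ _ => rfl)
  have a03 := mean_eq hG hG0 (C := fun x => cc 0 (x 3))
    (hcd (fun _ => 0) (fun x => x 3) (by fun_prop) (by fun_prop)) (fun x => cc_norm _ _) 0 3
    (by
      intro x
      have := hGF (rho 0 3 0 x)
      rw [hr _ (by simp [rho])] at this
      have e : rho 0 3 0 x 2 = 0 := by simp [rho]
      have e' : rho 0 3 0 x 3 = x 3 := by simp [rho]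
      rwa [e, e'] at this) hGp
    (by
      intro l x
      have := cc_per 0 (x 3) 0 ((Pi.single l 1 : Fin 4 → ℤ) 3)
      rw [← this]
      congr 1 <;> simp [Pi.single_apply])
  rw [hz (fun _ => 0) (fun _ => 0) (by fun_prop) (by fun_prop) (by simp) (by simp) 2] at a02
  rw [hz (fun _ => 0) (fun x => x 3) (by fun_prop) (by fun_prop) (by simp) (by simp) 3] at a03
  rw [a02, a03, a01, a23] at pl
  have n1 := mean_neg 0 1 (by decide)
  have n2 := mean_neg 2 3 (by decide)
  have := mul_pos_of_neg_of_neg n1 n2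
  linarith

end HS

/-- The 2-sphere is not an H-space: there is no continuous multiplication
`m : S² × S² → S²` with a two-sided (strict) identity element. -/
theorem stmt_10 :
    ¬ ∃ (m : (Metric.sphere (0 : EuclideanSpace ℝ (Fin 3)) 1) ×
            (Metric.sphere (0 : EuclideanSpace ℝ (Fin 3)) 1) →
            (Metric.sphere (0 : EuclideanSpace ℝ (Fin 3)) 1))
        (e : Metric.sphere (0 : EuclideanSpace ℝ (Fin 3)) 1),
      Continuous m ∧ ∀ y, m (e, y) = y ∧ m (y, e) = y := by
  rintro ⟨m, e, hm, he⟩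
  obtain ⟨R, hR⟩ : ∃ R : EuclideanSpace ℝ (Fin 3) ≃ₗᵢ[ℝ] EuclideanSpace ℝ (Fin 3),
      R (HS.cc 0 0) = e := by
    refine ⟨_, Submodule.reflection_sub (v := HS.cc 0 0) (w := (e : EuclideanSpace ℝ (Fin 3))) ?_⟩
    rw [HS.cc_norm]
    exact (mem_sphere_zero_iff_norm.1 e.2).symm
  let q : ℝ → ℝ → Metric.sphere (0 : EuclideanSpace ℝ (Fin 3)) 1 := fun s t =>
    ⟨R (HS.cc s t), by rw [mem_sphere_zero_iff_norm, R.norm_map, HS.cc_norm]⟩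
  have hq : Continuous (fun p : ℝ × ℝ => q p.1 p.2) :=
    (R.continuous.comp HS.cc_contDiff.continuous).subtype_mk _
  have hq' : ∀ i j : Fin 4, Continuous (fun x : Fin 4 → ℝ => q (x i) (x j)) := fun i j =>
    Continuous.comp (g := fun p : ℝ × ℝ => q p.1 p.2) (f := fun x : Fin 4 → ℝ => (x i, x j))
      hq (HS.pair_contDiff i j).continuous
  have hq0 : ∀ s, q s 0 = e := by
    intro s
    apply Subtype.ext
    simp only [q]
    rw [HS.cc_zero, hR]
  refine HS.core (F := fun x => R.symm (m (q (x 0) (x 1), q (x 2) (x 3)))) ?_ ?_ ?_ ?_ ?_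
  · refine R.symm.continuous.comp (continuous_subtype_val.comp (hm.comp ?_))
    exact Continuous.prodMk (hq' 0 1) (hq' 2 3)
  · intro x
    rw [R.symm.norm_map]
    exact mem_sphere_zero_iff_norm.1 (m _).2
  · intro x z
    simp only [q, HS.cc_per]
  · intro x hx
    simp only [hx, hq0, (he _).2]
    simp [q]
  · intro x hx
    simp only [hx, hq0, (he _).1]
    simp [q]
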